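/- arXiv:2312.03655 — 3 statements merged into one kernel-verified Lean document; each statement's English description precedes it below -/
import Mathlib

section
/- Let N be an integer with N ≥ 16. Then there exist prime numbers p and q with p ≠ q, p ∤ N, q ∤ N, and p ≤ 6.2·log N and q ≤ 6.2·log N. -/
open Chebyshev in
lemma theta_large (n : ℕ) (hn : 1024 ≤ n) :
    Real.log n + (n + 1) / 6.2 < Chebyshev.theta n := by
  have h := Chebyshev.theta_ge n
  have hn' : (1024 : ℝ) ≤ n := by exact_mod_cast hn
  set s := √(n : ℝ) with hs
  have hsq : s * s = n := Real.mul_self_sqrt (by positivity)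
  have hs32 : 32 ≤ s := Real.le_sqrt_of_sq_le (by norm_num; exact hn)
  have hl2 := Real.log_two_lt_d9
  have hl2' := Real.log_two_gt_d9
  have h1 : Real.log n ≤ 4.932 + s / 16 := by
    have e : Real.log n = 2 * (5 * Real.log 2 + Real.log (s / 32)) := by
      rw [Real.log_div (by positivity) (by norm_num), ← hsq,
        Real.log_mul (by positivity) (by positivity),
        show (32 : ℝ) = 2 ^ 5 by norm_num, Real.log_pow]
      push_cast; ring
    have := Real.log_le_sub_one_of_pos (show 0 < s / 32 by positivity)
    rw [e]; linarith
  have h2 : Real.log (n + 1) ≤ Real.log n + 1 := by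
    have e : Real.log (n + 1) = Real.log n + Real.log ((n + 1) / n) := by
      rw [Real.log_div (by positivity) (by positivity)]; ring
    have := Real.log_le_sub_one_of_pos (show 0 < ((n : ℝ) + 1) / n by positivity)
    have h3 : ((n : ℝ) + 1) / n ≤ 2 := by
      rw [div_le_iff₀ (by positivity)]; linarith
    linarith
  have h3 : 2 * s * Real.log n ≤ 2 * s * (4.932 + s / 16) := by gcongr
  have h4 : (n : ℝ) * 0.6931 ≤ n * Real.log 2 := by gcongr; linarith
  have h5 : 32 * s ≤ n := by rw [← hsq]; gcongr
  have h6 : 2 * s * (4.932 + s / 16) = 9.864 * s + n / 8 := by rw [← hsq]; ring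
  have h7 : ((n : ℝ) + 1) / 6.2 ≤ 0.1613 * (n + 1) := by
    rw [div_le_iff₀ (by norm_num)]; linarith
  linarith

lemma theta_step (a b k n : ℕ) (c : ℕ) (P : ℕ) (hP : primorial a = P) (h1 : a ≤ n) (h2 : n ≤ b)
    (hk : 2.7182818286 ^ k ≤ (P : ℝ)) (hc : (b : ℝ) ≤ 2 ^ c)
    (hb : (c : ℝ) * 0.6931471808 + (b + 1) / 6.2 < k) (hn0 : 0 < n) :
    Real.log n + (n + 1) / 6.2 < Chebyshev.theta n := by
  have hn : (0 : ℝ) < n := by exact_mod_cast hn0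
  have hnb : (n : ℝ) ≤ b := by exact_mod_cast h2
  have h3 : (k : ℝ) ≤ Chebyshev.theta a := by
    rw [Chebyshev.theta_eq_log_primorial, Nat.floor_natCast, hP]
    have hpos : (0 : ℝ) < P := lt_of_lt_of_le (by positivity) hk
    rw [Real.le_log_iff_exp_le hpos]
    refine le_trans ?_ hk
    rw [← mul_one (k : ℝ), Real.exp_nat_mul]
    have := Real.exp_one_lt_d9
    gcongr
  have h4 : Chebyshev.theta a ≤ Chebyshev.theta n := Chebyshev.theta_mono (by exact_mod_cast h1)
  have h5 : Real.log n ≤ c * 0.6931471808 := by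
    calc Real.log n ≤ Real.log (2 ^ c) := Real.log_le_log hn (hnb.trans hc)
      _ = c * Real.log 2 := by rw [Real.log_pow]
      _ ≤ _ := by have := Real.log_two_lt_d9; gcongr
  have h6 : ((n : ℝ) + 1) / 6.2 ≤ (b + 1) / 6.2 := by gcongr
  linarith

set_option maxRecDepth 100000 in
lemma theta_all (n : ℕ) (hn : 17 ≤ n) :
    Real.log n + (n + 1) / 6.2 < Chebyshev.theta n := by
  rcases le_total 1024 n with h | h
  · exact theta_large n h
  rcases le_total n 47 with h1 | h1
  · exact theta_step 17 47 13 n 6 _ (by decide +kernel : primorial 17 = 510510) hn h1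
      (by norm_num) (by norm_num) (by norm_num) (by omega)
  rcases le_total n 199 with h2 | h2
  · exact theta_step 47 199 40 n 8 _ (by decide +kernel : primorial 47 = 614889782588491410) h1 h2
      (by norm_num) (by norm_num) (by norm_num) (by omega)
  · exact theta_step 199 1024 175 n 10 _ (by decide +kernel : primorial 199 = 7799922041683461553249199106329813876687996789903550945093032474868511536164700810) h2 h
      (by norm_num) (by norm_num) (by norm_num) (by omega)

/-- Let `N` be an integer with `N ≥ 16`. Then there exist prime numbers
`p` and `q` with `p ≠ q`, `p ∤ N`, `q ∤ N`, and `p ≤ 6.2·log N`, `q ≤ 6.2·log N`. -/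
theorem exists_two_primes_not_dvd (N : ℤ) (hN : 16 ≤ N) :
    ∃ p q : ℕ, p.Prime ∧ q.Prime ∧ p ≠ q ∧ ¬((p : ℤ) ∣ N) ∧ ¬((q : ℤ) ∣ N) ∧
      (p : ℝ) ≤ 6.2 * Real.log (N : ℝ) ∧ (q : ℝ) ≤ 6.2 * Real.log (N : ℝ) := by
  lift N to ℕ using by omega
  have hN' : 16 ≤ N := by exact_mod_cast hN
  simp only [Int.natCast_dvd_natCast, Int.cast_natCast]
  have hNr : (16 : ℝ) ≤ N := by exact_mod_cast hN'
  have hlog : 4 * Real.log 2 ≤ Real.log N := by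
    calc 4 * Real.log 2 = Real.log (2 ^ 4) := by rw [Real.log_pow]; norm_num
      _ ≤ _ := Real.log_le_log (by norm_num) (by norm_num; exact hN')
  have hl2 := Real.log_two_gt_d9
  have hx0 : 0 ≤ 6.2 * Real.log (N : ℝ) := by nlinarith
  obtain ⟨n, hn⟩ : ∃ n, n = ⌊6.2 * Real.log (N : ℝ)⌋₊ := ⟨_, rfl⟩
  have hn17 : 17 ≤ n := by
    rw [hn]; apply Nat.le_floor; push_cast; linarith
  have hle : (n : ℝ) ≤ 6.2 * Real.log N := by rw [hn]; exact Nat.floor_le hx0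
  have hlt : 6.2 * Real.log N < n + 1 := by rw [hn]; exact Nat.lt_floor_add_one _
  have hθ := theta_all n hn17
  let S := (Nat.primesLE n).filter (fun p => ¬ p ∣ N)
  have hS : ∀ p ∈ S, p.Prime ∧ p ≤ n ∧ ¬ p ∣ N := by
    intro p hp
    simp only [S, Finset.mem_filter, Nat.mem_primesLE] at hp
    tauto
  by_cases hcard : 1 < S.card
  · obtain ⟨p, hp, q, hq, hpq⟩ := Finset.one_lt_card.mp hcard
    obtain ⟨a1, a2, a3⟩ := hS p hp
    obtain ⟨b1, b2, b3⟩ := hS q hq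
    refine ⟨p, q, a1, b1, hpq, a3, b3, le_trans ?_ hle, le_trans ?_ hle⟩ <;> assumption_mod_cast
  · exfalso
    have h1 : ∏ p ∈ S, p ≤ n := by
      refine (Finset.prod_le_pow_card S _ n (fun p hp => (hS p hp).2.1)).trans ?_
      calc n ^ S.card ≤ n ^ 1 := Nat.pow_le_pow_right (by omega) (by omega)
        _ = n := pow_one n
    have h2 : ∏ p ∈ (Nat.primesLE n).filter (fun p => p ∣ N), p ≤ N := by
      apply Nat.le_of_dvd (by omega)
      apply Finset.prod_primes_dvd
      · intro p hp
        simp only [Finset.mem_filter, Nat.mem_primesLE] at hp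
        exact hp.1.2.prime
      · intro p hp
        exact (Finset.mem_filter.mp hp).2
    have h3 : primorial n ≤ N * n := by
      rw [primorial_eq_prod_primesLE, ← Finset.prod_filter_mul_prod_filter_not _ (fun p => p ∣ N)]
      exact Nat.mul_le_mul h2 h1
    have h4 : Chebyshev.theta n ≤ Real.log N + Real.log n := by
      rw [Chebyshev.theta_eq_log_primorial, Nat.floor_natCast,
        ← Real.log_mul (by positivity) (by positivity)]
      apply Real.log_le_log
      · exact_mod_cast primorial_pos n
      · exact_mod_cast h3
    have h5 : Real.log N < (n + 1) / 6.2 := by rw [lt_div_iff₀ (by norm_num)]; linarith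
    linarith
end

section
/- Let k be a number field of degree d = [k : ℚ]. For every nonzero integral ideal I of 𝒪_k with absolute norm N(I) ≥ 3, the number ω_k(I) of distinct prime ideals of 𝒪_k dividing I satisfies ω_k(I) ≤ 1.3841·d · (log N(I)) / (log log N(I)). -/
open NumberField

lemma robin_key (S : Finset ℕ) (hS : ∀ p ∈ S, p.Prime) (N : ℕ) (z : ℝ) (hN : 0 < N)
    (h1 : (N : ℝ) ≤ z) (h2 : z ≤ N + 1) :
    (S.card : ℝ) * Real.log z ≤ ∑ p ∈ S, Real.log p +
      ∑ p ∈ Nat.primesLE N, (Real.log z - Real.log p) := by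
  have hN' : (0 : ℝ) < N := by exact_mod_cast hN
  have a1 : (S.card : ℝ) * Real.log z - ∑ p ∈ S, Real.log p
      = ∑ p ∈ S, (Real.log z - Real.log p) := by
    rw [Finset.sum_sub_distrib]; simp
  have a2 : ∑ p ∈ S, (Real.log z - Real.log p)
      ≤ ∑ p ∈ S with p ≤ N, (Real.log z - Real.log p) := by
    rw [Finset.sum_filter]
    apply Finset.sum_le_sum
    intro p hp
    split_ifs with h
    · exact le_rfl
    · have : (N : ℝ) + 1 ≤ p := by exact_mod_cast (by omega : N + 1 ≤ p)
      have := Real.log_le_log (by linarith) (h2.trans this)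
      linarith
  have a3 : ∑ p ∈ S with p ≤ N, (Real.log z - Real.log p)
      ≤ ∑ p ∈ Nat.primesLE N, (Real.log z - Real.log p) := by
    apply Finset.sum_le_sum_of_subset_of_nonneg
    · intro p hp
      rw [Finset.mem_filter] at hp
      rw [Nat.primesLE_eq_filter_range, Finset.mem_filter, Finset.mem_range]
      exact ⟨by omega, hS p hp.1⟩
    · intro p hp _
      rw [Nat.primesLE_eq_filter_range, Finset.mem_filter, Finset.mem_range] at hp
      have h3 : (p : ℝ) ≤ N := by exact_mod_cast (by omega : p ≤ N)
      have := Real.log_le_log (by exact_mod_cast hp.2.pos) (h3.trans h1)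
      linarith
  linarith

lemma robin_pi (m : ℕ) (hm : 30 ≤ m) : (Nat.primeCounting m : ℝ) ≤ 0.3841 * m := by
  have h36 : Nat.primeCounting 36 = 11 := by decide
  rcases le_total m 36 with h | h
  · have h1 := Nat.monotone_primeCounting h
    rw [h36] at h1
    have h1' : (Nat.primeCounting m : ℝ) ≤ 11 := by exact_mod_cast h1
    have : (30 : ℝ) ≤ m := by exact_mod_cast hm
    linarith
  · obtain ⟨n, rfl⟩ := Nat.exists_eq_add_of_le h
    have h1 := Nat.primeCounting_add_le (a := 6) (k := 36) (by norm_num) (by norm_num) n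
    rw [h36, show Nat.totient 6 = 2 by decide] at h1
    have h2 : 3 * Nat.primeCounting (36 + n) ≤ 39 + n := by omega
    have h2' : (3 : ℝ) * Nat.primeCounting (36 + n) ≤ 39 + n := by exact_mod_cast h2
    push_cast
    have : (0 : ℝ) ≤ n := by positivity
    linarith

lemma robin_E_step (N : ℕ) (hN : 30 ≤ N) (z : ℝ) (hz : (N : ℝ) ≤ z) :
    ∑ p ∈ Nat.primesLE N, (Real.log z - Real.log p) ≤
      ∑ p ∈ Nat.primesLE N, (Real.log N - Real.log p) + 0.3841 * (z - N) := by
  have hN' : (30 : ℝ) ≤ N := by exact_mod_cast hN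
  have h0 : ∑ p ∈ Nat.primesLE N, (Real.log z - Real.log p) =
      ∑ p ∈ Nat.primesLE N, (Real.log N - Real.log p) +
        Nat.primeCounting N * (Real.log z - Real.log N) := by
    rw [Finset.sum_sub_distrib, Finset.sum_sub_distrib]
    simp only [Finset.sum_const, Nat.primesLE_card_eq_primeCounting, nsmul_eq_mul]
    ring
  have h1 : Real.log z - Real.log N ≤ (z - N) / N := by
    rw [← Real.log_div (by linarith) (by linarith)]
    have := Real.log_le_sub_one_of_pos (x := z / N) (by apply div_pos <;> linarith)
    rw [sub_div, div_self (by linarith)]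
    exact this
  have h2 : (Nat.primeCounting N : ℝ) * (Real.log z - Real.log N) ≤
      0.3841 * N * ((z - N) / N) := by
    apply mul_le_mul (robin_pi N hN) h1
    · have := Real.log_le_log (by linarith) hz
      linarith
    · linarith
  have h3 : 0.3841 * (N : ℝ) * ((z - N) / N) = 0.3841 * (z - N) := by
    field_simp
  linarith

lemma robin_E (N : ℕ) (hN : 30 ≤ N) :
    ∑ p ∈ Nat.primesLE N, (Real.log N - Real.log p) ≤ 0.3841 * N := by
  induction N, hN using Nat.le_induction with
  | base =>
    have h : ∑ p ∈ Nat.primesLE 30, (Real.log (30 : ℕ) - Real.log p) =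
        Real.log (30 ^ 10 / 6469693230) := by
      have hne : ∀ p ∈ Nat.primesLE 30, (p : ℝ) ≠ 0 := by
        intro p hp
        rw [Nat.primesLE_eq_filter_range, Finset.mem_filter] at hp
        exact_mod_cast hp.2.ne_zero
      rw [Real.log_div (by norm_num) (by norm_num), Real.log_pow,
        Finset.sum_sub_distrib, ← Real.log_prod hne, Finset.sum_const, ← Nat.cast_prod,
        show (Nat.primesLE 30).card = 10 by decide,
        show ∏ p ∈ Nat.primesLE 30, p = 6469693230 by decide, nsmul_eq_mul]
      norm_num
    rw [h]
    have h2 : (2 : ℕ) * Real.log (30 ^ 10 / 6469693230) ≤ 23 := by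
      rw [← Real.log_pow, Real.log_le_iff_le_exp (by norm_num),
        show (23 : ℝ) = ((23 : ℕ) : ℝ) * 1 by norm_num, Real.exp_nat_mul]
      refine le_trans ?_ (pow_le_pow_left₀ (by norm_num) Real.exp_one_gt_d9.le 23)
      norm_num
    push_cast at h2 ⊢
    linarith
  | succ N hN ih =>
    have h1 := robin_E_step N hN ((N + 1 : ℕ) : ℝ) (by push_cast; linarith)
    have h2 : ∑ p ∈ Nat.primesLE (N + 1), (Real.log ((N + 1 : ℕ) : ℝ) - Real.log p) =
        ∑ p ∈ Nat.primesLE N, (Real.log ((N + 1 : ℕ) : ℝ) - Real.log p) := by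
      symm
      apply Finset.sum_subset
      · intro p hp
        rw [Nat.primesLE_eq_filter_range, Finset.mem_filter, Finset.mem_range] at hp ⊢
        exact ⟨by omega, hp.2⟩
      · intro p hp hp'
        rw [Nat.primesLE_eq_filter_range, Finset.mem_filter, Finset.mem_range] at hp hp'
        have : p = N + 1 := by
          by_contra hne
          exact hp' ⟨by omega, hp.2⟩
        rw [this, sub_self]
    rw [h2]
    push_cast at h1 ⊢
    linarith

/-- The large case. -/
lemma robin_large (S : Finset ℕ) (hS : ∀ p ∈ S, p.Prime) (y : ℝ) (hy : 30 ≤ y)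
    (h : ∑ p ∈ S, Real.log p ≤ y) : (S.card : ℝ) * Real.log y ≤ 1.3841 * y := by
  have hN : 30 ≤ ⌊y⌋₊ := Nat.le_floor (by exact_mod_cast hy)
  have h1 : (⌊y⌋₊ : ℝ) ≤ y := Nat.floor_le (by linarith)
  have h2 := robin_key S hS ⌊y⌋₊ y (by omega) h1 (Nat.lt_floor_add_one y).le
  have h3 := robin_E_step ⌊y⌋₊ hN y h1
  have h4 := robin_E ⌊y⌋₊ hN
  linarith

/-- Lower bound on the sum of logarithms of `k` primes. -/
lemma robin_theta (S : Finset ℕ) (hS : ∀ p ∈ S, p.Prime) (q P k a b : ℕ) (hq : 0 < q)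
    (hb : 0 < b) (hk : (Nat.primesLE q).card = k) (hP : ∏ p ∈ Nat.primesLE q, p = P)
    (hab : (2.7182818286 : ℝ) ^ a ≤ (P : ℝ) ^ b) :
    (a / b : ℝ) + (S.card - k) * Real.log q ≤ ∑ p ∈ S, Real.log p := by
  have h := robin_key S hS q q hq le_rfl (by linarith)
  have hne : ∀ p ∈ Nat.primesLE q, (p : ℝ) ≠ 0 := by
    intro p hp
    rw [Nat.primesLE_eq_filter_range, Finset.mem_filter] at hp
    exact_mod_cast hp.2.ne_zero
  rw [Finset.sum_sub_distrib, ← Real.log_prod hne, Finset.sum_const, hk, nsmul_eq_mul,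
    ← Nat.cast_prod, hP] at h
  have hPpos : (0 : ℝ) < P := by
    rw [← hP, Nat.cast_prod]
    apply Finset.prod_pos
    intro p hp
    exact lt_of_le_of_ne (by positivity) (hne p hp).symm
  have h2 : (a : ℝ) ≤ b * Real.log P := by
    rw [← Real.log_pow, Real.le_log_iff_exp_le (by positivity),
      show (a : ℝ) = (a : ℝ) * 1 by ring, Real.exp_nat_mul]
    exact (pow_le_pow_left₀ (by positivity) Real.exp_one_lt_d9.le a).trans hab
  have hb' : (0 : ℝ) < b := by exact_mod_cast hb
  have h3 : (a / b : ℝ) ≤ Real.log P := by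
    rw [div_le_iff₀ hb']; linarith
  linarith

lemma robin_mid (S : Finset ℕ) (hS : ∀ p ∈ S, p.Prime) (q P k a b c m : ℕ) (hq : 0 < q)
    (ha : 0 < a) (hb : 0 < b) (hm : 0 < m)
    (hk : (Nat.primesLE q).card = k) (hP : ∏ p ∈ Nat.primesLE q, p = P)
    (hab : (2.7182818286 : ℝ) ^ a ≤ (P : ℝ) ^ b)
    (hc : (a / b : ℝ) ^ (m * k) ≤ (2.7182818283 : ℝ) ^ c)
    (hcm : (c / m : ℝ) ≤ 1.3841 * (a / b)) (hkab : (k : ℝ) ≤ 1.3841 * (a / b))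
    (hSk : S.card = k)
    (y : ℝ) (h : ∑ p ∈ S, Real.log p ≤ y) : (S.card : ℝ) * Real.log y ≤ 1.3841 * y := by
  have h1 := robin_theta S hS q P k a b hq hb hk hP hab
  rw [hSk] at h1 ⊢
  rw [sub_self, zero_mul, add_zero] at h1
  have hw : (0 : ℝ) < a / b := by positivity
  generalize (a / b : ℝ) = w at *
  have hwy : w ≤ y := h1.trans h
  have hm' : (0 : ℝ) < m := by exact_mod_cast hm
  have h2 : (m * k : ℕ) * Real.log w ≤ c := by
    rw [← Real.log_pow, Real.log_le_iff_le_exp (by positivity),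
      show (c : ℝ) = (c : ℝ) * 1 by ring, Real.exp_nat_mul]
    exact hc.trans (pow_le_pow_left₀ (by norm_num) Real.exp_one_gt_d9.le c)
  have h3 : (k : ℝ) * Real.log w ≤ 1.3841 * w := by
    refine le_trans ?_ hcm
    rw [le_div_iff₀ hm']
    push_cast at h2
    linarith
  have h4 : Real.log y ≤ Real.log w + (y / w - 1) := by
    have := Real.log_le_sub_one_of_pos (x := y / w) (by apply div_pos <;> linarith)
    rw [Real.log_div (by linarith) (by linarith)] at this
    linarith
  have h5 : (k : ℝ) * (y / w - 1) ≤ 1.3841 * w * (y / w - 1) := by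
    apply mul_le_mul_of_nonneg_right hkab
    rw [sub_nonneg, le_div_iff₀ hw]; linarith
  have h6 : 1.3841 * w * (y / w - 1) = 1.3841 * y - 1.3841 * w := by
    field_simp
  have h7 := mul_le_mul_of_nonneg_left h4 (by positivity : (0 : ℝ) ≤ k)
  linarith

set_option exponentiation.threshold 3000 in
lemma robin_set (S : Finset ℕ) (hS : ∀ p ∈ S, p.Prime) (y : ℝ) (hy : 1 < y)
    (h : ∑ p ∈ S, Real.log p ≤ y) : (S.card : ℝ) * Real.log y ≤ 1.3841 * y := by
  rcases Nat.lt_or_ge S.card 4 with h4 | h4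
  · have h1 : Real.log y ≤ y / 2.7182818283 := by
      have a1 : Real.exp 1 * Real.log y ≤ y := by
        have := Real.exp_one_mul_le_exp (x := Real.log y)
        rwa [Real.exp_log (by linarith)] at this
      have a2 := mul_le_mul_of_nonneg_right Real.exp_one_gt_d9.le (Real.log_pos hy).le
      rw [le_div_iff₀ (by norm_num)]
      linarith
    have h2 : (S.card : ℝ) ≤ 3 := by exact_mod_cast (by omega : S.card ≤ 3)
    have h3 := mul_le_mul_of_nonneg_right h2 (Real.log_pos hy).le
    refine h3.trans ((mul_le_mul_of_nonneg_left h1 (by norm_num)).trans ?_)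
    rw [mul_div_assoc', div_le_iff₀ (by norm_num)]
    linarith
  rcases Nat.lt_or_ge S.card 13 with h13 | h13
  · obtain hk | hk | hk | hk | hk | hk | hk | hk | hk : S.card = 4 ∨ S.card = 5 ∨ S.card = 6 ∨
        S.card = 7 ∨ S.card = 8 ∨ S.card = 9 ∨ S.card = 10 ∨ S.card = 11 ∨ S.card = 12 := by omega
    · exact robin_mid S hS 7 210 4 5 1 13 2 (by norm_num) (by norm_num)
        (by norm_num) (by norm_num) (by decide) (by decide) (by norm_num) (by norm_num)
        (by norm_num) (by norm_num) hk y h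
    · exact robin_mid S hS 11 2310 5 15 2 31 3 (by norm_num) (by norm_num)
        (by norm_num) (by norm_num) (by decide) (by decide) (by norm_num) (by norm_num)
        (by norm_num) (by norm_num) hk y h
    · exact robin_mid S hS 13 30030 6 10 1 83 6 (by norm_num) (by norm_num)
        (by norm_num) (by norm_num) (by decide) (by decide) (by norm_num) (by norm_num)
        (by norm_num) (by norm_num) hk y h
    · exact robin_mid S hS 17 510510 7 13 1 413 23 (by norm_num) (by norm_num)
        (by norm_num) (by norm_num) (by decide) (by decide) (by norm_num) (by norm_num)
        (by norm_num) (by norm_num) hk y h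
    · exact robin_mid S hS 19 9699690 8 193 12 89 4 (by norm_num) (by norm_num)
        (by norm_num) (by norm_num) (by decide) (by decide) (by norm_num) (by norm_num)
        (by norm_num) (by norm_num) hk y h
    · exact robin_mid S hS 23 223092870 9 173 9 1011 38 (by norm_num) (by norm_num)
        (by norm_num) (by norm_num) (by decide) (by decide) (by norm_num) (by norm_num)
        (by norm_num) (by norm_num) hk y h
    · exact robin_mid S hS 29 6469693230 10 45 2 685 22 (by norm_num) (by norm_num)
        (by norm_num) (by norm_num) (by decide) (by decide) (by norm_num) (by norm_num)
        (by norm_num) (by norm_num) hk y h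
    · exact robin_mid S hS 31 200560490130 11 26 1 251 7 (by norm_num) (by norm_num)
        (by norm_num) (by norm_num) (by decide) (by decide) (by norm_num) (by norm_num)
        (by norm_num) (by norm_num) hk y h
    · exact robin_mid S hS 37 7420738134810 12 59 2 122 3 (by norm_num) (by norm_num)
        (by norm_num) (by norm_num) (by decide) (by decide) (by norm_num) (by norm_num)
        (by norm_num) (by norm_num) hk y h
  · have h1 := robin_theta S hS 37 7420738134810 12 59 2 (by norm_num) (by norm_num)
      (by decide) (by decide) (by norm_num)
    have h2 : (13 : ℝ) ≤ S.card := by exact_mod_cast h13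
    have h3 : (1 : ℝ) ≤ Real.log (37 : ℕ) := by
      rw [Real.le_log_iff_exp_le (by norm_num)]
      have := Real.exp_one_lt_d9
      push_cast
      linarith
    have h4 : (1 : ℝ) * 1 ≤ (S.card - (12 : ℕ)) * Real.log (37 : ℕ) := by
      apply mul_le_mul _ h3 (by norm_num)
      · push_cast; linarith
      · push_cast; linarith
    apply robin_large S hS y _ h
    push_cast at h1 h4
    linarith

lemma robin_nat (n : ℕ) (hn : 3 ≤ n) :
    (n.primeFactors.card : ℝ) ≤ 1.3841 * (Real.log n / Real.log (Real.log n)) := by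
  have hn' : (3 : ℝ) ≤ n := by exact_mod_cast hn
  have hy : 1 < Real.log n := by
    rw [Real.lt_log_iff_exp_lt (by linarith)]
    have := Real.exp_one_lt_d9
    linarith
  have h : ∑ p ∈ n.primeFactors, Real.log p ≤ Real.log n := by
    have hne : ∀ p ∈ n.primeFactors, (p : ℝ) ≠ 0 := by
      intro p hp
      exact_mod_cast (Nat.prime_of_mem_primeFactors hp).ne_zero
    rw [← Real.log_prod hne, ← Nat.cast_prod]
    have h1 := Nat.le_of_dvd (by omega) (Nat.prod_primeFactors_dvd n)
    apply Real.log_le_log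
    · have : 0 < ∏ p ∈ n.primeFactors, p :=
        Finset.prod_pos fun p hp => (Nat.prime_of_mem_primeFactors hp).pos
      exact_mod_cast this
    · exact_mod_cast h1
  have := robin_set n.primeFactors (fun p hp => Nat.prime_of_mem_primeFactors hp) _ hy h
  rw [mul_div_assoc', le_div_iff₀ (Real.log_pos hy)]
  exact this

open Classical in
lemma omega_ideal_le (k : Type*) [Field k] [NumberField k]
    (I : Ideal (𝓞 k)) (hN : 3 ≤ Ideal.absNorm I) :
    {P : Ideal (𝓞 k) | P.IsPrime ∧ P ∣ I}.ncard ≤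
      Module.finrank ℚ k * (Ideal.absNorm I).primeFactors.card := by
  have hI : I ≠ 0 := by
    rintro rfl
    simp at hN
  set T : Finset (Ideal (𝓞 k)) := (Ideal.absNorm I).primeFactors.biUnion
    (fun p => IsDedekindDomain.primesOverFinset (Ideal.span {(p : ℤ)}) (𝓞 k)) with hT
  have hp0 : ∀ p ∈ (Ideal.absNorm I).primeFactors, Ideal.span {(p : ℤ)} ≠ ⊥ := by
    intro p hp
    have := (Nat.prime_of_mem_primeFactors hp).ne_zero
    simpa using this
  have hmax : ∀ p ∈ (Ideal.absNorm I).primeFactors, (Ideal.span {(p : ℤ)}).IsMaximal := by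
    intro p hp
    have h1 : (Ideal.span {(p : ℤ)}).IsPrime := by
      rw [Ideal.span_singleton_prime (by simpa using (Nat.prime_of_mem_primeFactors hp).ne_zero)]
      exact Nat.prime_iff_prime_int.mp (Nat.prime_of_mem_primeFactors hp)
    exact h1.isMaximal (hp0 p hp)
  have hsub : {P : Ideal (𝓞 k) | P.IsPrime ∧ P ∣ I} ⊆ (T : Set (Ideal (𝓞 k))) := by
    rintro P ⟨hP, hPI⟩
    have hPbot : P ≠ ⊥ := by
      rintro rfl
      exact hI (zero_dvd_iff.mp hPI)
    have hmem : ((Ideal.absNorm I : ℕ) : 𝓞 k) ∈ P := Ideal.le_of_dvd hPI (Ideal.absNorm_mem I)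
    obtain ⟨p, hp, hpP⟩ : ∃ p ∈ (Ideal.absNorm I).primeFactors, (p : 𝓞 k) ∈ P := by
      have hdec := Nat.prod_primeFactorsList (n := Ideal.absNorm I) (by omega)
      rw [← hdec, Nat.cast_list_prod, ← Multiset.prod_coe] at hmem
      obtain ⟨x, hx, hxP⟩ := (hP.multiset_prod_mem_iff_exists_mem _).mp hmem
      rw [Multiset.mem_coe] at hx
      rw [List.mem_map] at hx
      obtain ⟨p, hp, rfl⟩ := hx
      exact ⟨p, by rwa [Nat.mem_primeFactors_iff_mem_primeFactorsList], hxP⟩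
    rw [hT, Finset.mem_coe, Finset.mem_biUnion]
    refine ⟨p, hp, ?_⟩
    haveI := hmax p hp
    rw [IsDedekindDomain.mem_primesOverFinset_iff (hp0 p hp)]
    refine ⟨hP, ⟨?_⟩⟩
    apply (hmax p hp).eq_of_le (Ideal.IsPrime.ne_top (hP.comap _))
    rw [Ideal.span_singleton_le_iff_mem]
    simpa using hpP
  calc _ ≤ (T : Set (Ideal (𝓞 k))).ncard := Set.ncard_le_ncard hsub (Finset.finite_toSet T)
    _ = T.card := Set.ncard_coe_finset T
    _ ≤ _ := by
      rw [mul_comm]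
      apply Finset.card_biUnion_le_card_mul
      intro p hp
      haveI := hmax p hp
      exact Ideal.card_primesOverFinset_le_finrank (𝓞 k) ℚ k (hp0 p hp)

/-- Let `k` be a number field of degree `d = [k : ℚ]`. For every nonzero
integral ideal `I` of `𝒪_k` with absolute norm `N(I) ≥ 3`, the number `ω_k(I)` of distinct
prime ideals of `𝒪_k` dividing `I` satisfies
`ω_k(I) ≤ 1.3841·d · log N(I) / log log N(I)`. -/
theorem omega_le_log_div_log_log (k : Type*) [Field k] [NumberField k]
    (I : Ideal (𝓞 k)) (hI : I ≠ 0) (hN : 3 ≤ Ideal.absNorm I) :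
    ({P : Ideal (𝓞 k) | P.IsPrime ∧ P ∣ I}.ncard : ℝ) ≤
      1.3841 * (Module.finrank ℚ k : ℝ) *
        (Real.log (Ideal.absNorm I : ℝ) / Real.log (Real.log (Ideal.absNorm I : ℝ))) := by
  have h1 := omega_ideal_le k I hN
  have h2 := robin_nat _ hN
  have h1' : ({P : Ideal (𝓞 k) | P.IsPrime ∧ P ∣ I}.ncard : ℝ) ≤
      (Module.finrank ℚ k : ℝ) * ((Ideal.absNorm I).primeFactors.card : ℝ) := by
    exact_mod_cast h1
  have h3 := mul_le_mul_of_nonneg_left h2 (Nat.cast_nonneg (α := ℝ) (Module.finrank ℚ k))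
  linarith
end

section
/- Let B be a real number with log B ≥ e, and for x ≥ e define f(x) = (x / log x) · log(log B / x). Then for all x ≥ e one has f(x) ≤ (16/e²) · (log B) / (log log B). -/
/-- Let `B` be a real number with `log B ≥ e`, and for `x ≥ e` set
`f(x) = (x / log x) · log(log B / x)`. Then for all `x ≥ e` one has
`f(x) ≤ (16/e²) · (log B) / (log log B)`. -/
theorem f_le_log_div_log_log (B : ℝ) (hB : Real.exp 1 ≤ Real.log B)
    (x : ℝ) (hx : Real.exp 1 ≤ x) :
    x / Real.log x * Real.log (Real.log B / x) ≤
      16 / Real.exp 1 ^ 2 * (Real.log B / Real.log (Real.log B)) := by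
  have he := Real.exp_pos 1
  have hx0 : 0 < x := he.trans_le hx
  have hL0 : 0 < Real.log B := he.trans_le hB
  have hu : 1 ≤ Real.log x := (Real.le_log_iff_exp_le hx0).2 hx
  have hl : 1 ≤ Real.log (Real.log B) := (Real.le_log_iff_exp_le hL0).2 hB
  generalize Real.log B = L at *
  have hd : Real.log (L / x) = Real.log L - Real.log x := Real.log_div hL0.ne' hx0.ne'
  have hexp : Real.exp (Real.log (L / x)) = L / x := Real.exp_log (by positivity)
  have hLx : L = x * Real.exp (Real.log (L / x)) := by rw [hexp]; field_simp
  have h2 : (2 : ℝ) ≤ 16 / Real.exp 1 ^ 2 := by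
    rw [le_div_iff₀ (by positivity)]
    nlinarith [Real.exp_one_lt_d9]
  have hll : Real.log L = Real.log x + Real.log (L / x) := by rw [hd]; ring
  generalize Real.log (L / x) = d at *
  have hR : 0 ≤ L / Real.log L := by positivity
  rcases le_total d 0 with h | h
  · have h1 : x / Real.log x * d ≤ 0 :=
      mul_nonpos_of_nonneg_of_nonpos (by positivity) h
    have h3 : 0 ≤ 16 / Real.exp 1 ^ 2 * (L / Real.log L) := by positivity
    linarith
  · refine le_trans ?_ (mul_le_mul_of_nonneg_right h2 hR)
    have hq := Real.quadratic_le_exp_of_nonneg h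
    have h4 : d * Real.log L ≤ 2 * Real.exp d * Real.log x := by
      have h5 : d * Real.log L ≤ (d + d ^ 2) * Real.log x := by
        rw [hll]; nlinarith [mul_nonneg (sq_nonneg d) (sub_nonneg.2 hu)]
      have h6 : d + d ^ 2 ≤ 2 * Real.exp d := by linarith
      exact h5.trans (mul_le_mul_of_nonneg_right h6 (by linarith))
    rw [div_mul_eq_mul_div, ← mul_div_assoc, div_le_div_iff₀ (by linarith) (by linarith)]
    calc x * d * Real.log L = x * (d * Real.log L) := by ring
      _ ≤ x * (2 * Real.exp d * Real.log x) := mul_le_mul_of_nonneg_left h4 hx0.le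
      _ = 2 * (x * Real.exp d) * Real.log x := by ring
      _ = 2 * L * Real.log x := by rw [← hLx]
end
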